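/- Let Ω ⊂ ℝⁿ be a domain, λ > 0, and f ∈ bmo_λ(Ω). Suppose lim_{t→0⁺} ω_Ω(f,t) = 0 and for every ℓ > 0 the quantity C_ℓ := sup{ |f|_Q : Q a cube with 2Q ⊂ Ω and ℓ(Q) ≥ ℓ } is finite (here 2Q is the cube concentric with Q of sidelength 2ℓ(Q)). Then there exist bounded measurable functions g_k on Ω with ‖f − g_k‖_{bmo_λ(Ω)} → 0; in fact there is a constant C depending only on n such that for every 0 < ℓ < λ/(8√n) there is a bounded function g with ‖f − g‖_{bmo_λ(Ω)} ≤ C·ω_Ω(f, 4√n ℓ). -/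

import Mathlib

open MeasureTheory Metric Filter Topology

noncomputable section

/-- A closed axis-parallel cube in ℝⁿ: a closed ball in the sup norm with
positive radius (`half` = half the sidelength). -/
structure Cube (n : ℕ) where
  center : Fin n → ℝ
  half : ℝ
  half_pos : 0 < half

namespace Cube

variable {n : ℕ}

/-- The underlying set of a cube. -/
def toSet (Q : Cube n) : Set (Fin n → ℝ) := Metric.closedBall Q.center Q.half

/-- The sidelength ℓ(Q). -/
def side (Q : Cube n) : ℝ := 2 * Q.half

/-- The mean f_Q of f over Q. -/
def avg (Q : Cube n) (f : (Fin n → ℝ) → ℝ) : ℝ := ⨍ x in Q.toSet, f x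

/-- Mean oscillation of f over Q. -/
def osc (Q : Cube n) (f : (Fin n → ℝ) → ℝ) : ℝ := ⨍ x in Q.toSet, |f x - Q.avg f|

/-- The mean |f|_Q of |f| over Q. -/
def avgAbs (Q : Cube n) (f : (Fin n → ℝ) → ℝ) : ℝ := ⨍ x in Q.toSet, |f x|

/-- Distance from the cube to the origin. -/
def distToOrigin (Q : Cube n) : ℝ := Metric.infDist (0 : Fin n → ℝ) Q.toSet

/-- The cube 2Q, concentric with Q and of twice the sidelength. -/
def double (Q : Cube n) : Cube n := ⟨Q.center, 2 * Q.half, mul_pos two_pos Q.half_pos⟩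

end Cube

variable {n : ℕ}

/-- The modulus of mean oscillation ω_U(f,t): the supremum of the mean oscillation
of f over cubes Q ⊆ U of sidelength < t. -/
def omegaOn (U : Set (Fin n → ℝ)) (f : (Fin n → ℝ) → ℝ) (t : ℝ) : ℝ :=
  sSup {r | ∃ Q : Cube n, Q.toSet ⊆ U ∧ Q.side < t ∧ r = Q.osc f}

/-- sup{ |f|_Q : Q ⊆ U, ℓ(Q) ≥ lam }. -/
def bigAvgSup (U : Set (Fin n → ℝ)) (lam : ℝ) (f : (Fin n → ℝ) → ℝ) : ℝ :=
  sSup {r | ∃ Q : Cube n, Q.toSet ⊆ U ∧ lam ≤ Q.side ∧ r = Q.avgAbs f}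

/-- The nonhomogeneous norm ‖f‖_{bmo_lam(U)}. -/
def bmoNorm (U : Set (Fin n → ℝ)) (lam : ℝ) (f : (Fin n → ℝ) → ℝ) : ℝ :=
  omegaOn U f lam + bigAvgSup U lam f

/-- Membership in bmo_lam(U): integrable on every cube in U and finite norm. -/
def MemBmo (U : Set (Fin n → ℝ)) (lam : ℝ) (f : (Fin n → ℝ) → ℝ) : Prop :=
  (∀ Q : Cube n, Q.toSet ⊆ U → IntegrableOn f Q.toSet) ∧
  BddAbove {r | ∃ Q : Cube n, Q.toSet ⊆ U ∧ Q.side < lam ∧ r = Q.osc f} ∧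
  BddAbove {r | ∃ Q : Cube n, Q.toSet ⊆ U ∧ lam ≤ Q.side ∧ r = Q.avgAbs f}

/-- Sarason's vanishing mean oscillation condition: ω_U(f,t) → 0 as t → 0⁺. -/
def VanishSmallOsc (U : Set (Fin n → ℝ)) (f : (Fin n → ℝ) → ℝ) : Prop :=
  Tendsto (fun t => omegaOn U f t) (nhdsWithin 0 (Set.Ioi 0)) (nhds 0)

/-- f is bounded on U. -/
def BoundedOn (U : Set (Fin n → ℝ)) (f : (Fin n → ℝ) → ℝ) : Prop :=
  ∃ M : ℝ, ∀ x ∈ U, |f x| ≤ M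

/-- f is Lipschitz on U. -/
def LipschitzOn (U : Set (Fin n → ℝ)) (f : (Fin n → ℝ) → ℝ) : Prop :=
  ∃ K : NNReal, LipschitzOnWith K f U

/-- dist(supp f, ∂U) > 0. -/
def SuppAway (U : Set (Fin n → ℝ)) (f : (Fin n → ℝ) → ℝ) : Prop :=
  ∃ d > 0, ∀ x ∈ Function.support f, ∀ y ∈ frontier U, d ≤ dist x y

/-- The nonhomogeneous Lipschitz norm ‖f‖_{Lip_b(U)} = ‖f‖_∞ + Lipschitz seminorm. -/
def lipbNorm (U : Set (Fin n → ℝ)) (f : (Fin n → ℝ) → ℝ) : ℝ :=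
  sSup {r | ∃ x ∈ U, r = |f x|} +
  sSup {r | ∃ x ∈ U, ∃ y ∈ U, x ≠ y ∧ r = |f x - f y| / dist x y}

/-- U is a domain: a nonempty open connected subset of ℝⁿ. -/
def IsRealDomain (U : Set (Fin n → ℝ)) : Prop := IsOpen U ∧ IsConnected U

/-- U is an (ε,δ)-domain. -/
def IsEpsDeltaDomain (U : Set (Fin n → ℝ)) (ε δ : ℝ) : Prop :=
  ∀ x ∈ U, ∀ y ∈ U, dist x y < δ →
    ∃ γ : ℝ → (Fin n → ℝ), ContinuousOn γ (Set.Icc 0 1) ∧ γ 0 = x ∧ γ 1 = y ∧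
      (∀ t ∈ Set.Icc (0:ℝ) 1, γ t ∈ U) ∧
      eVariationOn γ (Set.Icc 0 1) ≤ ENNReal.ofReal (ε⁻¹ * dist x y) ∧
      ∀ t ∈ Set.Icc (0:ℝ) 1,
        ε * (dist (γ t) x * dist (γ t) y) / dist x y ≤ Metric.infDist (γ t) (frontier U)

/-- The natural scale λ_{ε,δ} for an (ε,δ)-domain. -/
def lamED (n : ℕ) (ε δ : ℝ) : ℝ := ε ^ 2 * δ / (320 * n * (1 + Real.sqrt n * ε))

/-- d_Ω(x) = dist(x,∂Ω). -/
def distBd (U : Set (Fin n → ℝ)) (x : Fin n → ℝ) : ℝ := Metric.infDist x (frontier U)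

/-- Ω̊_t = {x ∈ Ω : d_Ω(x) ≥ t}. -/
def innerPart (U : Set (Fin n → ℝ)) (t : ℝ) : Set (Fin n → ℝ) :=
  {x ∈ U | t ≤ distBd U x}

/-- f vanishes at infinity in the bmo_lam(U) sense. -/
def VanishAtInfinity (U : Set (Fin n → ℝ)) (lam : ℝ) (f : (Fin n → ℝ) → ℝ) : Prop :=
  Tendsto (fun R => bmoNorm (U \ Metric.closedBall 0 R) lam f) atTop (nhds 0)

/-- f vanishes at the boundary in the bmo_lam(U) sense. -/
def VanishAtBoundary (U : Set (Fin n → ℝ)) (lam : ℝ) (f : (Fin n → ℝ) → ℝ) : Prop :=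
  Tendsto (fun t => bmoNorm (U \ innerPart U t) lam f) (nhdsWithin 0 (Set.Ioi 0)) (nhds 0)

/-- f is in the bmo_lam(U)-closure of the continuous functions with compact support in U. -/
def InCmoClosure (U : Set (Fin n → ℝ)) (lam : ℝ) (f : (Fin n → ℝ) → ℝ) : Prop :=
  ∃ g : ℕ → (Fin n → ℝ) → ℝ,
    (∀ j, Continuous (g j) ∧ HasCompactSupport (g j) ∧ tsupport (g j) ⊆ U) ∧
    Tendsto (fun j => bmoNorm U lam (f - g j)) atTop (nhds 0)

/-- The homogeneous BMO(ℝⁿ) seminorm: sup of mean oscillation over all cubes. -/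
def bmoHNorm (f : (Fin n → ℝ) → ℝ) : ℝ := sSup {r | ∃ Q : Cube n, r = Q.osc f}

namespace Cube

theorem side_pos (Q : Cube n) : 0 < Q.side := mul_pos two_pos Q.half_pos

theorem volume_real_toSet (Q : Cube n) : volume.real Q.toSet = Q.side ^ n := by
  rw [measureReal_def, toSet, Real.volume_pi_closedBall _ Q.half_pos.le, Fintype.card_fin,
    ENNReal.toReal_ofReal (by have := Q.half_pos; positivity), side]

theorem volume_toSet_ne_top (Q : Cube n) : volume Q.toSet ≠ ⊤ :=
  measure_closedBall_lt_top.ne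

theorem setAverage_toSet (Q : Cube n) (f : (Fin n → ℝ) → ℝ) :
    ⨍ x in Q.toSet, f x = (Q.side ^ n)⁻¹ * ∫ x in Q.toSet, f x := by
  rw [setAverage_eq, volume_real_toSet, smul_eq_mul]

theorem integrableOn_const (Q : Cube n) (c : ℝ) : IntegrableOn (fun _ => c) Q.toSet :=
  MeasureTheory.integrableOn_const Q.volume_toSet_ne_top

theorem setAverage_const (Q : Cube n) (c : ℝ) : ⨍ _ in Q.toSet, c = c := by
  have := pow_pos Q.side_pos n
  rw [setAverage_toSet, setIntegral_const, volume_real_toSet, smul_eq_mul]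
  field_simp

theorem setAverage_mono (Q : Cube n) {f g : (Fin n → ℝ) → ℝ} (hf : IntegrableOn f Q.toSet)
    (hg : IntegrableOn g Q.toSet) (h : ∀ᵐ x ∂volume.restrict Q.toSet, f x ≤ g x) :
    ⨍ x in Q.toSet, f x ≤ ⨍ x in Q.toSet, g x := by
  rw [setAverage_toSet, setAverage_toSet]
  have := pow_pos Q.side_pos n
  gcongr ?_ * ?_
  exact integral_mono_ae hf hg h

theorem setAverage_add (Q : Cube n) {f g : (Fin n → ℝ) → ℝ} (hf : IntegrableOn f Q.toSet)
    (hg : IntegrableOn g Q.toSet) :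
    ⨍ x in Q.toSet, (f x + g x) = (⨍ x in Q.toSet, f x) + ⨍ x in Q.toSet, g x := by
  rw [setAverage_toSet, setAverage_toSet, setAverage_toSet, integral_add hf hg, mul_add]

theorem setAverage_nonneg (Q : Cube n) {f : (Fin n → ℝ) → ℝ} (hf : ∀ x, 0 ≤ f x) :
    0 ≤ ⨍ x in Q.toSet, f x := by
  have := pow_pos Q.side_pos n
  rw [setAverage_toSet]
  exact mul_nonneg (by positivity) (integral_nonneg hf)

theorem osc_nonneg (Q : Cube n) (f : (Fin n → ℝ) → ℝ) : 0 ≤ Q.osc f :=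
  Q.setAverage_nonneg fun _ => abs_nonneg _

theorem avgAbs_nonneg (Q : Cube n) (f : (Fin n → ℝ) → ℝ) : 0 ≤ Q.avgAbs f :=
  Q.setAverage_nonneg fun _ => abs_nonneg _

theorem integrableOn_abs_sub_const (Q : Cube n) {f : (Fin n → ℝ) → ℝ}
    (hf : IntegrableOn f Q.toSet) (c : ℝ) : IntegrableOn (fun x => |f x - c|) Q.toSet :=
  (hf.sub (Q.integrableOn_const c)).abs

theorem abs_avg_sub_le (Q : Cube n) {f : (Fin n → ℝ) → ℝ} (hf : IntegrableOn f Q.toSet) (c : ℝ) :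
    |Q.avg f - c| ≤ ⨍ x in Q.toSet, |f x - c| := by
  have h1 : Q.avg f ≤ ⨍ x in Q.toSet, (|f x - c| + c) :=
    Q.setAverage_mono hf ((Q.integrableOn_abs_sub_const hf c).add (Q.integrableOn_const c))
      (.of_forall fun x => by linarith [le_abs_self (f x - c)])
  have h2 : ⨍ _ in Q.toSet, c ≤ ⨍ x in Q.toSet, (|f x - c| + f x) :=
    Q.setAverage_mono (Q.integrableOn_const c) ((Q.integrableOn_abs_sub_const hf c).add hf)
      (.of_forall fun x => by linarith [neg_abs_le (f x - c)])
  rw [Q.setAverage_add (Q.integrableOn_abs_sub_const hf c) (Q.integrableOn_const c),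
    setAverage_const] at h1
  rw [Q.setAverage_add (Q.integrableOn_abs_sub_const hf c) hf, setAverage_const] at h2
  rw [abs_le]
  unfold avg at *
  constructor <;> linarith

/-- The mean oscillation is at most twice the mean distance to any constant. -/
theorem osc_le_two_mul (Q : Cube n) {f : (Fin n → ℝ) → ℝ} (hf : IntegrableOn f Q.toSet) (c : ℝ) :
    Q.osc f ≤ 2 * ⨍ x in Q.toSet, |f x - c| := by
  have h : Q.osc f ≤ ⨍ x in Q.toSet, (|f x - c| + |Q.avg f - c|) :=
    Q.setAverage_mono (Q.integrableOn_abs_sub_const hf _)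
      ((Q.integrableOn_abs_sub_const hf c).add (Q.integrableOn_const _))
      (.of_forall fun x => by
        have := abs_sub_le (f x) c (Q.avg f)
        rwa [abs_sub_comm c] at this)
  rw [Q.setAverage_add (Q.integrableOn_abs_sub_const hf c) (Q.integrableOn_const _),
    setAverage_const] at h
  linarith [Q.abs_avg_sub_le hf c]

theorem osc_le_two_mul_avgAbs (Q : Cube n) {f : (Fin n → ℝ) → ℝ} (hf : IntegrableOn f Q.toSet) :
    Q.osc f ≤ 2 * Q.avgAbs f := by
  simpa [avgAbs] using Q.osc_le_two_mul hf 0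

/-- The average over the double of a cube is controlled by the mean of `|f|` over the cube and
the mean oscillation over the double. -/
theorem abs_avg_double_le (Q : Cube n) {f : (Fin n → ℝ) → ℝ}
    (hf : IntegrableOn f Q.double.toSet) :
    |Q.double.avg f| ≤ Q.avgAbs f + 2 ^ n * Q.double.osc f := by
  set c := Q.double.avg f
  have hsub : Q.toSet ⊆ Q.double.toSet :=
    closedBall_subset_closedBall (by have := Q.half_pos; simp only [double]; linarith)
  have hfQ := hf.mono_set hsub
  have h : ⨍ _ in Q.toSet, |c| ≤ ⨍ x in Q.toSet, (|f x| + |f x - c|) :=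
    Q.setAverage_mono (Q.integrableOn_const _)
      (hfQ.abs.add (Q.integrableOn_abs_sub_const hfQ c))
      (.of_forall fun x => by
        have := abs_sub (f x) (f x - c)
        rwa [sub_sub_cancel] at this)
  rw [Q.setAverage_add hfQ.abs (Q.integrableOn_abs_sub_const hfQ c), setAverage_const] at h
  have h2 : ⨍ x in Q.toSet, |f x - c| ≤ 2 ^ n * Q.double.osc f := by
    have hs := pow_pos Q.side_pos n
    have hd : Q.double.side = 2 * Q.side := rfl
    rw [osc, setAverage_toSet, setAverage_toSet, hd, mul_pow]
    have e : (2 : ℝ) ^ n * ((2 ^ n * Q.side ^ n)⁻¹ * ∫ x in Q.double.toSet, |f x - c|)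
        = (Q.side ^ n)⁻¹ * ∫ x in Q.double.toSet, |f x - c| := by
      field_simp
    rw [e]
    gcongr ?_ * ?_
    exact setIntegral_mono_set (Q.double.integrableOn_abs_sub_const hf c)
      (.of_forall fun x => abs_nonneg _) hsub.eventuallyLE
  unfold avgAbs
  linarith

/-- The cell with index `j` in the subdivision of a cube into `N ^ n` congruent cubes. -/
def cell (Q : Cube n) (N : ℕ) (hN : 0 < N) (j : Fin n → Fin N) : Cube n where
  center i := Q.center i - Q.half + (2 * (j i : ℝ) + 1) * (Q.half / N)
  half := Q.half / N
  half_pos := div_pos Q.half_pos (Nat.cast_pos.2 hN)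

theorem side_cell (Q : Cube n) (N : ℕ) (hN : 0 < N) (j : Fin n → Fin N) :
    (Q.cell N hN j).side = Q.side / N := by
  simp only [cell, side]; ring

theorem mem_toSet (Q : Cube n) (x : Fin n → ℝ) :
    x ∈ Q.toSet ↔ ∀ i, Q.center i - Q.half ≤ x i ∧ x i ≤ Q.center i + Q.half := by
  rw [toSet, mem_closedBall, dist_pi_le_iff Q.half_pos.le]
  refine forall_congr' fun i => ?_
  rw [Real.dist_eq, abs_le]
  constructor <;> rintro ⟨h, h'⟩ <;> constructor <;> linarith

theorem cell_subset (Q : Cube n) (N : ℕ) (hN : 0 < N) (j : Fin n → Fin N) :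
    (Q.cell N hN j).toSet ⊆ Q.toSet := by
  intro x hx
  rw [mem_toSet] at hx ⊢
  intro i
  have hN' : (0 : ℝ) < N := Nat.cast_pos.2 hN
  have hd : 0 < Q.half / N := div_pos Q.half_pos hN'
  have hj : (j i : ℝ) + 1 ≤ N := by exact_mod_cast (j i).2
  have hj0 : (0 : ℝ) ≤ j i := Nat.cast_nonneg _
  have hNd : N * (Q.half / N) = Q.half := by field_simp
  have h := hx i
  simp only [cell] at h
  constructor <;> nlinarith

theorem subset_iUnion_cell (Q : Cube n) (N : ℕ) (hN : 0 < N) :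
    Q.toSet ⊆ ⋃ j, (Q.cell N hN j).toSet := by
  intro x hx
  rw [mem_toSet] at hx
  have hN' : (0 : ℝ) < N := Nat.cast_pos.2 hN
  have hd : 0 < Q.half / N := div_pos Q.half_pos hN'
  have hNd : N * (Q.half / N) = Q.half := by field_simp
  have key : ∀ i, ∃ k : Fin N, 2 * (k : ℝ) * (Q.half / N) ≤ x i - (Q.center i - Q.half) ∧
      x i - (Q.center i - Q.half) ≤ (2 * (k : ℝ) + 2) * (Q.half / N) := by
    intro i
    obtain ⟨h1, h2⟩ := hx i
    set y := (x i - (Q.center i - Q.half)) / (2 * (Q.half / N)) with hy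
    have hyx : x i - (Q.center i - Q.half) = y * (2 * (Q.half / N)) := by
      rw [hy, div_mul_cancel₀ _ (by positivity)]
    have hy0 : 0 ≤ y := div_nonneg (by linarith) (by positivity)
    have hyN : y ≤ N := by
      rw [hy, div_le_iff₀ (by positivity)]
      nlinarith
    rw [hyx]
    rcases lt_or_ge ⌊y⌋₊ N with hlt | hge
    · refine ⟨⟨⌊y⌋₊, hlt⟩, ?_, ?_⟩
      · nlinarith [Nat.floor_le hy0]
      · nlinarith [Nat.lt_floor_add_one y]
    · have hNy : (N : ℝ) ≤ y := (Nat.le_floor_iff hy0).1 hge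
      have hc : ((N - 1 : ℕ) : ℝ) = N - 1 := by
        rw [Nat.cast_sub hN, Nat.cast_one]
      refine ⟨⟨N - 1, by omega⟩, ?_, ?_⟩ <;> simp only [hc] <;> nlinarith
  choose j hj using key
  refine Set.mem_iUnion.2 ⟨j, ?_⟩
  rw [mem_toSet]
  intro i
  obtain ⟨h1, h2⟩ := hj i
  simp only [cell]
  constructor <;> nlinarith

/-- A uniform bound for the means of a nonnegative function over the cells of a subdivision
bounds its mean over the whole cube. -/
theorem setAverage_le_of_cell (Q : Cube n) (N : ℕ) (hN : 0 < N) {f : (Fin n → ℝ) → ℝ}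
    (hf : IntegrableOn f Q.toSet) (hf0 : ∀ x, 0 ≤ f x) {A : ℝ}
    (h : ∀ j, ⨍ x in (Q.cell N hN j).toSet, f x ≤ A) :
    ⨍ x in Q.toSet, f x ≤ A := by
  have hN' : (0 : ℝ) < N := Nat.cast_pos.2 hN
  have hs := pow_pos Q.side_pos n
  have hle : volume.restrict Q.toSet ≤
      Measure.sum fun j => volume.restrict (Q.cell N hN j).toSet :=
    (Measure.restrict_mono (Q.subset_iUnion_cell N hN) le_rfl).trans Measure.restrict_iUnion_le
  have hcell (j : Fin n → Fin N) : Integrable f (volume.restrict (Q.cell N hN j).toSet) :=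
    hf.mono_set (Q.cell_subset N hN j)
  rw [Measure.sum_fintype] at hle
  have h1 : ∫ x in Q.toSet, f x ≤ ∑ j, ∫ x in (Q.cell N hN j).toSet, f x := by
    rw [← integral_finsetSum_measure fun j _ => hcell j]
    exact integral_mono_measure hle (.of_forall hf0)
      (integrable_finsetSum_measure.2 fun j _ => hcell j)
  have h2 (j : Fin n → Fin N) :
      ∫ x in (Q.cell N hN j).toSet, f x ≤ (Q.side / N) ^ n * A := by
    have := h j
    rw [setAverage_toSet, side_cell] at this
    rwa [inv_mul_le_iff₀ (pow_pos (div_pos Q.side_pos hN') n)] at this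
  rw [setAverage_toSet, inv_mul_le_iff₀ hs]
  refine (h1.trans (Finset.sum_le_sum fun j _ => h2 j)).trans_eq ?_
  simp only [Finset.sum_const, Finset.card_univ, Fintype.card_fun, Fintype.card_fin,
    nsmul_eq_mul, Nat.cast_pow]
  rw [div_pow]
  field_simp

end Cube

/-- The truncation of a real number to `[-M, M]`. -/
def clamp (M x : ℝ) : ℝ := max (-M) (min M x)

theorem abs_clamp_le {M : ℝ} (hM : 0 ≤ M) (x : ℝ) : |clamp M x| ≤ M :=
  abs_le.2 ⟨le_max_left _ _, max_le (by linarith) (min_le_left _ _)⟩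

theorem measurable_clamp (M : ℝ) : Measurable (clamp M) :=
  measurable_const.max (measurable_const.min measurable_id)

theorem abs_sub_clamp_sub_le (M x y : ℝ) :
    |(x - clamp M x) - (y - clamp M y)| ≤ |x - y| := by
  unfold clamp
  grind

theorem clamp_eq_self {M x : ℝ} (hx : |x| ≤ M) : clamp M x = x := by
  rw [abs_le] at hx
  rw [clamp, min_eq_right hx.2, max_eq_right hx.1]

theorem omegaOn_nonneg (U : Set (Fin n → ℝ)) (f : (Fin n → ℝ) → ℝ) (t : ℝ) :
    0 ≤ omegaOn U f t :=
  Real.sSup_nonneg (by rintro _ ⟨Q, -, -, rfl⟩; exact Q.osc_nonneg f)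

theorem bmoNorm_nonneg (U : Set (Fin n → ℝ)) (lam : ℝ) (f : (Fin n → ℝ) → ℝ) :
    0 ≤ bmoNorm U lam f :=
  add_nonneg (omegaOn_nonneg U f lam)
    (Real.sSup_nonneg (by rintro _ ⟨Q, -, -, rfl⟩; exact Q.avgAbs_nonneg f))

theorem MemBmo.osc_le_omegaOn {U : Set (Fin n → ℝ)} {lam t : ℝ} {f : (Fin n → ℝ) → ℝ}
    (hf : MemBmo U lam f) (ht : t ≤ lam) {Q : Cube n} (hQ : Q.toSet ⊆ U) (hQt : Q.side < t) :
    Q.osc f ≤ omegaOn U f t := by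
  refine le_csSup (hf.2.1.mono ?_) ⟨Q, hQ, hQt, rfl⟩
  rintro _ ⟨R, hR, hRt, rfl⟩
  exact ⟨R, hR, hRt.trans_le ht, rfl⟩

theorem MemBmo.aemeasurable {U : Set (Fin n → ℝ)} {lam : ℝ} {f : (Fin n → ℝ) → ℝ}
    (hU : IsOpen U) (hf : MemBmo U lam f) : AEMeasurable f (volume.restrict U) := by
  refine AEStronglyMeasurable.aemeasurable (LocallyIntegrableOn.aestronglyMeasurable ?_)
  intro x hx
  obtain ⟨r, hr, hrU⟩ := nhds_basis_closedBall.mem_iff.1 (hU.mem_nhds hx)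
  exact ⟨closedBall x r, mem_nhdsWithin_of_mem_nhds (closedBall_mem_nhds x hr),
    hf.1 ⟨x, r, hr⟩ hrU⟩

/-- A function in `bmo` whose means over large cubes well inside `U` are bounded is approximated
by a truncation, up to the modulus of mean oscillation. -/
theorem MemBmo.exists_bounded_bmoNorm_sub_le {U : Set (Fin n → ℝ)} {lam t : ℝ}
    {f : (Fin n → ℝ) → ℝ} (hU : IsOpen U) (hf : MemBmo U lam f) (ht : 0 < t) (htl : t ≤ lam)
    (hbdd : BddAbove {r | ∃ Q : Cube n, Q.double.toSet ⊆ U ∧ t / 4 ≤ Q.side ∧ r = Q.avgAbs f}) :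
    ∃ g : (Fin n → ℝ) → ℝ, BoundedOn U g ∧ Measurable g ∧
      bmoNorm U lam (f - g) ≤ 3 * omegaOn U f t := by
  obtain ⟨B, hB⟩ := hbdd
  have hω := omegaOn_nonneg U f t
  set M := max B 0 + 2 ^ n * omegaOn U f t with hMdef
  have hM : 0 ≤ M := by positivity
  have hmeas := hf.aemeasurable hU
  set f' := hmeas.mk f with hf'
  have hae : ∀ Q : Cube n, Q.toSet ⊆ U → ∀ᵐ x ∂volume.restrict Q.toSet,
      (f - fun x => clamp M (f' x)) x = f x - clamp M (f x) := by
    intro Q hQ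
    filter_upwards [ae_restrict_of_ae_restrict_of_subset hQ hmeas.ae_eq_mk] with x hx
    simp only [Pi.sub_apply, hf', ← hx]
  have hgm : Measurable fun x => clamp M (f' x) :=
    (measurable_clamp M).comp hmeas.measurable_mk
  have hint : ∀ Q : Cube n, Q.toSet ⊆ U →
      IntegrableOn (f - fun x => clamp M (f' x)) Q.toSet := by
    intro Q hQ
    refine (hf.1 Q hQ).sub ((Q.integrableOn_const M).mono' hgm.aestronglyMeasurable ?_)
    exact .of_forall fun x => abs_clamp_le hM _
  have hcomp : ∀ Q : Cube n, Q.toSet ⊆ U →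
      ⨍ x in Q.toSet, |(f - fun x => clamp M (f' x)) x - (Q.avg f - clamp M (Q.avg f))| ≤
        Q.osc f := by
    intro Q hQ
    refine Q.setAverage_mono (Q.integrableOn_abs_sub_const (hint Q hQ) _)
      (Q.integrableOn_abs_sub_const (hf.1 Q hQ) _) ?_
    filter_upwards [hae Q hQ] with x hx
    rw [hx]
    exact abs_sub_clamp_sub_le _ _ _
  have hmid : ∀ Q : Cube n, Q.toSet ⊆ U → Q.side < t → t / 2 ≤ Q.side →
      Q.avgAbs (f - fun x => clamp M (f' x)) ≤ omegaOn U f t := by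
    intro Q hQ hQt hQt'
    let P : Cube n := ⟨Q.center, Q.half / 2, half_pos Q.half_pos⟩
    have hP : P.double = Q := by
      cases Q
      simp only [P, Cube.double, Cube.mk.injEq, true_and]
      ring
    have hPs : t / 4 ≤ P.side := by
      simp only [Cube.side, P] at hQt' ⊢
      linarith
    have h1 := P.abs_avg_double_le (f := f) (by rw [hP]; exact hf.1 Q hQ)
    have h2 : P.avgAbs f ≤ B := hB ⟨P, by rwa [hP], hPs, rfl⟩
    rw [hP] at h1
    have h3 := hf.osc_le_omegaOn htl hQ hQt
    have h4 : |Q.avg f| ≤ M := by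
      refine h1.trans ?_
      rw [hMdef]
      gcongr
      exact h2.trans (le_max_left _ _)
    have h5 := hcomp Q hQ
    rw [clamp_eq_self h4] at h5
    simp only [sub_self, sub_zero] at h5
    exact h5.trans h3
  have hbig : ∀ Q : Cube n, Q.toSet ⊆ U → t ≤ Q.side →
      Q.avgAbs (f - fun x => clamp M (f' x)) ≤ omegaOn U f t := by
    intro Q hQ hQt
    have hN : 0 < ⌊Q.side / t⌋₊ + 1 := Nat.succ_pos _
    have hle := Nat.floor_le (div_nonneg Q.side_pos.le ht.le)
    have hlt := Nat.lt_floor_add_one (Q.side / t)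
    refine Q.setAverage_le_of_cell _ hN (hint Q hQ).abs (fun x => abs_nonneg _) fun j => ?_
    refine hmid _ ((Q.cell_subset _ hN j).trans hQ) ?_ ?_
    · rw [Cube.side_cell, Nat.cast_add, Nat.cast_one, div_lt_iff₀ (by positivity)]
      rwa [div_lt_iff₀ ht, mul_comm] at hlt
    · rw [Cube.side_cell, Nat.cast_add, Nat.cast_one, le_div_iff₀ (by positivity)]
      rw [le_div_iff₀ ht] at hle
      nlinarith
  refine ⟨fun x => clamp M (f' x), ⟨M, fun x _ => abs_clamp_le hM _⟩, hgm, ?_⟩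
  have hosc : omegaOn U (f - fun x => clamp M (f' x)) lam ≤ 2 * omegaOn U f t := by
    refine Real.sSup_le ?_ (by positivity)
    rintro _ ⟨Q, hQ, -, rfl⟩
    rcases lt_or_ge Q.side t with hQt | hQt
    · exact (Q.osc_le_two_mul (hint Q hQ) _).trans
        (by linarith [hcomp Q hQ, hf.osc_le_omegaOn htl hQ hQt])
    · exact (Q.osc_le_two_mul_avgAbs (hint Q hQ)).trans (by linarith [hbig Q hQ hQt])
  have havg : bigAvgSup U lam (f - fun x => clamp M (f' x)) ≤ omegaOn U f t := by
    refine Real.sSup_le ?_ hω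
    rintro _ ⟨Q, hQ, hQl, rfl⟩
    exact hbig Q hQ (htl.trans hQl)
  unfold bmoNorm
  linarith

/-- Lemma: if f ∈ bmo_λ(Ω) has vanishing mean oscillation and the averages |f|_Q over
cubes with 2Q ⊂ Ω and ℓ(Q) ≥ ℓ are uniformly bounded for every ℓ > 0, then f can be
approximated in bmo_λ(Ω) by bounded measurable functions; quantitatively, there is
C = C(n) such that for every 0 < ℓ < λ/(8√n) there is a bounded function g with
‖f − g‖_{bmo_λ(Ω)} ≤ C·ω_Ω(f, 4√n ℓ). -/
theorem stmt17 (n : ℕ) (hn : 0 < n) :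
    ∃ C : ℝ, 0 < C ∧ ∀ Ω : Set (Fin n → ℝ), IsRealDomain Ω →
      ∀ lam : ℝ, 0 < lam → ∀ f : (Fin n → ℝ) → ℝ, MemBmo Ω lam f →
      VanishSmallOsc Ω f →
      (∀ l : ℝ, 0 < l →
        BddAbove {r | ∃ Q : Cube n, Q.double.toSet ⊆ Ω ∧ l ≤ Q.side ∧ r = Q.avgAbs f}) →
      (∃ g : ℕ → (Fin n → ℝ) → ℝ,
          (∀ k, BoundedOn Ω (g k) ∧ Measurable (g k)) ∧
          Tendsto (fun k => bmoNorm Ω lam (f - g k)) atTop (nhds 0)) ∧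
      ∀ l : ℝ, 0 < l → l < lam / (8 * Real.sqrt n) →
        ∃ g : (Fin n → ℝ) → ℝ, BoundedOn Ω g ∧ Measurable g ∧
          bmoNorm Ω lam (f - g) ≤ C * omegaOn Ω f (4 * Real.sqrt n * l) := by
  refine ⟨3, by norm_num, fun Ω hΩ lam hlam f hf hvan hbdd => ?_⟩
  have hn' : 0 < Real.sqrt n := Real.sqrt_pos.2 (Nat.cast_pos.2 hn)
  have main : ∀ l : ℝ, 0 < l → l < lam / (8 * Real.sqrt n) →
      ∃ g : (Fin n → ℝ) → ℝ, BoundedOn Ω g ∧ Measurable g ∧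
        bmoNorm Ω lam (f - g) ≤ 3 * omegaOn Ω f (4 * Real.sqrt n * l) := by
    intro l hl hl'
    rw [lt_div_iff₀ (by positivity)] at hl'
    have ht : 0 < 4 * Real.sqrt n * l := by positivity
    exact hf.exists_bounded_bmoNorm_sub_le hΩ.1 ht (by nlinarith)
      (hbdd _ (div_pos ht (by norm_num)))
  refine ⟨?_, main⟩
  set L := lam / (8 * Real.sqrt n) with hL
  have hL0 : 0 < L := by positivity
  have hseq : ∀ k : ℕ, 0 < L / ((k : ℝ) + 2) ∧ L / ((k : ℝ) + 2) < L := fun k =>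
    ⟨by positivity, div_lt_self hL0 (by linarith [(Nat.cast_nonneg k : (0 : ℝ) ≤ k)])⟩
  choose g hgb hgm hg using fun k => main _ (hseq k).1 (hseq k).2
  refine ⟨g, fun k => ⟨hgb k, hgm k⟩, ?_⟩
  have hlim : Tendsto (fun k : ℕ => 4 * Real.sqrt n * (L / ((k : ℝ) + 2))) atTop (𝓝[>] 0) := by
    refine tendsto_nhdsWithin_iff.2 ⟨?_, .of_forall fun k => ?_⟩
    · have h : Tendsto (fun k : ℕ => L / ((k : ℝ) + 2)) atTop (𝓝 0) :=
        (tendsto_atTop_add_const_right _ _ tendsto_natCast_atTop_atTop).const_div_atTop L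
      simpa using h.const_mul (4 * Real.sqrt n)
    · exact mul_pos (by positivity) (hseq k).1
  have h3 := (Tendsto.comp hvan hlim).const_mul 3
  rw [mul_zero] at h3
  exact squeeze_zero (fun k => bmoNorm_nonneg _ _ _) hg h3
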